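/- (Theorem 3.1, Crank–Nicholson mass conservation.) Let τ ∈ ℝ and let u⁰, u¹ : Fin N → ℝ (coerced into Fin N → ℂ) satisfy the Crank–Nicholson scheme u¹ − u⁰ = τ·f_M(w) with w := (u⁰ + u¹)/2, where f_M(w) := B_{HS2}w − (1/(m+1))·(w^{∘(m−1)} ⊙ (B_{S1}w) + B_{S1}(w^{∘m})). Then the discrete mass is conserved exactly: ⟨u¹, u¹⟩_h = ⟨u⁰, u⁰⟩_h. -/

import Mathlib

open Matrix Complex BigOperators

noncomputable section

/-- The shifted integer index `k̂ = k - N/2` associated to `k ∈ Fin N`. -/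
def khat (N : ℕ) (k : Fin N) : ℤ := (k : ℤ) - (N : ℤ) / 2

/-- The collocation angles `θ_j = 2π ĵ / N`. -/
def theta (N : ℕ) (j : Fin N) : ℝ := 2 * Real.pi * (khat N j : ℝ) / N

/-- The discrete Fourier matrix `F`, `F_{k,j} = (1/N) exp(-i k̂ θ_j)`. -/
def Fm (N : ℕ) : Matrix (Fin N) (Fin N) ℂ :=
  Matrix.of fun k j => (N : ℂ)⁻¹ * Complex.exp (-Complex.I * (khat N k : ℂ) * (theta N j : ℂ))

/-- The inverse discrete Fourier matrix `G`, `G_{j,k} = exp(i k̂ θ_j)`. -/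
def Gm (N : ℕ) : Matrix (Fin N) (Fin N) ℂ :=
  Matrix.of fun j k => Complex.exp (Complex.I * (khat N k : ℂ) * (theta N j : ℂ))

/-- The diagonal weight matrix `P = diag(α - i x_j)`. -/
def Pm (N : ℕ) (α : ℝ) (x : Fin N → ℝ) : Matrix (Fin N) (Fin N) ℂ :=
  Matrix.diagonal fun j => (α : ℂ) - Complex.I * (x j : ℂ)

/-- The diagonal matrix `P⁻¹ = diag((α - i x_j)⁻¹)`. -/
def PinvM (N : ℕ) (α : ℝ) (x : Fin N → ℝ) : Matrix (Fin N) (Fin N) ℂ :=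
  Matrix.diagonal fun j => ((α : ℂ) - Complex.I * (x j : ℂ))⁻¹

/-- The diagonal matrix `P̄ = diag(α + i x_j)`. -/
def PbarM (N : ℕ) (α : ℝ) (x : Fin N → ℝ) : Matrix (Fin N) (Fin N) ℂ :=
  Matrix.diagonal fun j => (α : ℂ) + Complex.I * (x j : ℂ)

/-- The discrete Hilbert transform matrix `H = diag(-i sgn(k̂))` with `sgn(0) = 1`. -/
def Hm (N : ℕ) : Matrix (Fin N) (Fin N) ℂ :=
  Matrix.diagonal fun k => if 0 ≤ khat N k then -Complex.I else Complex.I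

/-- The tridiagonal differentiation matrix `S1`:
`(S1)_{k,k-1} = i k̂/(2α)`, `(S1)_{k,k} = i (2k̂+1)/(2α)`, `(S1)_{k,k+1} = i (k̂+1)/(2α)`. -/
def S1 (N : ℕ) (α : ℝ) : Matrix (Fin N) (Fin N) ℂ :=
  Matrix.of fun k l =>
    if (l : ℤ) = (k : ℤ) - 1 then Complex.I * (khat N k : ℂ) / (2 * (α : ℂ))
    else if (l : ℤ) = (k : ℤ) then Complex.I * (2 * (khat N k : ℂ) + 1) / (2 * (α : ℂ))
    else if (l : ℤ) = (k : ℤ) + 1 then Complex.I * ((khat N k : ℂ) + 1) / (2 * (α : ℂ))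
    else 0

/-- The second-derivative matrix `S2 = S1 · S1`. -/
def S2 (N : ℕ) (α : ℝ) : Matrix (Fin N) (Fin N) ℂ := S1 N α * S1 N α

/-- The discrete inner product `⟨u,v⟩_h = (π/(Nα)) Σ_j (α² + x_j²) u_j conj(v_j)`. -/
def iph (N : ℕ) (α : ℝ) (x : Fin N → ℝ) (u v : Fin N → ℂ) : ℂ :=
  ((Real.pi / (N * α) : ℝ) : ℂ) *
    ∑ j, ((α ^ 2 + x j ^ 2 : ℝ) : ℂ) * u j * (starRingEnd ℂ) (v j)

/-- The conjugated first-derivative operator `B_{S1} = P⁻¹ G S1 F P`. -/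
def BS1 (N : ℕ) (α : ℝ) (x : Fin N → ℝ) : Matrix (Fin N) (Fin N) ℂ :=
  PinvM N α x * Gm N * S1 N α * Fm N * Pm N α x

/-- The conjugated operator `B_{HS1} = P⁻¹ G H S1 F P`. -/
def BHS1 (N : ℕ) (α : ℝ) (x : Fin N → ℝ) : Matrix (Fin N) (Fin N) ℂ :=
  PinvM N α x * Gm N * Hm N * S1 N α * Fm N * Pm N α x

/-- The conjugated dispersion operator `B_{HS2} = P⁻¹ G H S2 F P`. -/
def BHS2 (N : ℕ) (α : ℝ) (x : Fin N → ℝ) : Matrix (Fin N) (Fin N) ℂ :=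
  PinvM N α x * Gm N * Hm N * S2 N α * Fm N * Pm N α x

/-- Coercion of a real vector into a complex vector. -/
def cv (N : ℕ) (u : Fin N → ℝ) : Fin N → ℂ := fun j => (u j : ℂ)

/-- Entrywise `m`-th power of a complex vector. -/
def pw (N : ℕ) (m : ℕ) (u : Fin N → ℂ) : Fin N → ℂ := fun j => u j ^ m

/-- The mass-conservative semi-discrete right-hand side
`f_M(w) = B_{HS2} w - (1/(m+1)) (w^{∘(m-1)} ⊙ (B_{S1} w) + B_{S1}(w^{∘m}))`. -/
def fM (N : ℕ) (α : ℝ) (x : Fin N → ℝ) (m : ℕ) (w : Fin N → ℂ) : Fin N → ℂ :=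
  fun j => (BHS2 N α x *ᵥ w) j
    - (1 / ((m : ℂ) + 1)) *
        ((w j) ^ (m - 1) * (BS1 N α x *ᵥ w) j + (BS1 N α x *ᵥ pw N m w) j)

/-- The energy-conservative semi-discrete right-hand side
`f_E(w) = -B_{S1}(-B_{HS1} w + (1/m) w^{∘m})`. -/
def fE (N : ℕ) (α : ℝ) (x : Fin N → ℝ) (m : ℕ) (w : Fin N → ℂ) : Fin N → ℂ :=
  -(BS1 N α x *ᵥ (-(BHS1 N α x *ᵥ w) + (1 / (m : ℂ)) • pw N m w))

/-- The semi-discrete energy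
`E_h(w) = (1/2)⟨B_{HS1} w, w⟩_h - (1/(m(m+1)))⟨w^{∘m}, w⟩_h`. -/
def Eh (N : ℕ) (α : ℝ) (x : Fin N → ℝ) (m : ℕ) (w : Fin N → ℂ) : ℂ :=
  (1 / 2 : ℂ) * iph N α x (BHS1 N α x *ᵥ w) w
    - (1 / ((m : ℂ) * ((m : ℂ) + 1))) * iph N α x (pw N m w) w

end

/-- The diagonal matrix of quadrature weights `α² + x_j²`. -/
noncomputable def weightM (N : ℕ) (α : ℝ) (x : Fin N → ℝ) : Matrix (Fin N) (Fin N) ℂ :=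
  Matrix.diagonal fun j => ((α ^ 2 + x j ^ 2 : ℝ) : ℂ)

lemma weightM_mul_PinvM (N : ℕ) (α : ℝ) (hα : α ≠ 0) (x : Fin N → ℝ) :
    weightM N α x * PinvM N α x = (Pm N α x)ᴴ := by
  rw [weightM, PinvM, Pm, diagonal_mul_diagonal, diagonal_conjTranspose]
  congr 1
  funext j
  have h : (α : ℂ) - I * (x j : ℂ) ≠ 0 := fun h => hα (by simpa using congrArg Complex.re h)
  rw [mul_inv_eq_iff_eq_mul₀ h]
  simp only [Pi.star_apply, RCLike.star_def, map_sub, map_mul, conj_I, conj_ofReal]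
  push_cast
  linear_combination (x j : ℂ) ^ 2 * I_sq

lemma Gm_eq_smul_conjTranspose_Fm (N : ℕ) (hN : N ≠ 0) : Gm N = (N : ℂ) • (Fm N)ᴴ := by
  ext j k
  have h : (N : ℂ) ≠ 0 := Nat.cast_ne_zero.mpr hN
  simp [Gm, Fm, ← Complex.exp_conj, h]

/-- Conjugating a skew-Hermitian spectral matrix by the weighted discrete Fourier transform gives
an operator that is skew-adjoint for the discrete inner product. -/
lemma conjTranspose_weightM_mul (N : ℕ) (hN : N ≠ 0) (α : ℝ) (hα : α ≠ 0) (x : Fin N → ℝ)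
    (A : Matrix (Fin N) (Fin N) ℂ) (hA : Aᴴ = -A) :
    (weightM N α x * (PinvM N α x * Gm N * A * Fm N * Pm N α x))ᴴ
      = -(weightM N α x * (PinvM N α x * Gm N * A * Fm N * Pm N α x)) := by
  have h : weightM N α x * (PinvM N α x * Gm N * A * Fm N * Pm N α x)
      = (N : ℂ) • ((Pm N α x)ᴴ * (Fm N)ᴴ * A * Fm N * Pm N α x) := by
    simp only [← Matrix.mul_assoc, weightM_mul_PinvM N α hα, Gm_eq_smul_conjTranspose_Fm N hN,
      Matrix.mul_smul, Matrix.smul_mul]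
  rw [h]
  simp [conjTranspose_mul, hA, Matrix.mul_assoc]

lemma conjTranspose_S1 (N : ℕ) (α : ℝ) : (S1 N α)ᴴ = -S1 N α := by
  ext k l
  simp only [conjTranspose_apply, S1, of_apply, Matrix.neg_apply]
  rcases lt_trichotomy (k : ℤ) l with h | h | h
  · by_cases h1 : (l : ℤ) = k + 1
    · have hk : khat N l = khat N k + 1 := by simp only [khat]; omega
      rw [if_pos (by omega), if_neg (by omega), if_neg (by omega), if_pos h1, hk]
      simp [neg_div]
    · rw [if_neg (by omega), if_neg (by omega), if_neg (by omega), if_neg (by omega),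
        if_neg (by omega), if_neg (by omega)]
      simp
  · have hk : khat N l = khat N k := by simp only [khat]; omega
    rw [if_neg (by omega), if_pos h, if_neg (by omega), if_pos h.symm, hk]
    simp [neg_div]
  · by_cases h1 : (k : ℤ) = l + 1
    · have hk : khat N k = khat N l + 1 := by simp only [khat]; omega
      rw [if_neg (by omega), if_neg (by omega), if_pos h1, if_pos (by omega), hk]
      simp [neg_div]
    · rw [if_neg (by omega), if_neg (by omega), if_neg (by omega), if_neg (by omega),
        if_neg (by omega), if_neg (by omega)]
      simp

lemma conjTranspose_Hm (N : ℕ) : (Hm N)ᴴ = -Hm N := by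
  rw [Hm, diagonal_conjTranspose, diagonal_neg]
  congr 1
  funext k
  by_cases h : 0 ≤ khat N k <;> simp [h]

/-- `S1` does not couple the nonnegative and the negative frequencies. -/
lemma commute_Hm_S1 (N : ℕ) (α : ℝ) : Commute (Hm N) (S1 N α) := by
  ext k l
  rw [Hm, diagonal_mul, mul_diagonal, mul_comm]
  by_cases hkl : 0 ≤ khat N k ↔ 0 ≤ khat N l
  · simp only [hkl]
  · have h0 : S1 N α k l = 0 := by
      simp only [S1, of_apply]
      simp only [khat] at hkl
      split_ifs with h1 h2 h3
      · have : khat N k = 0 := by simp only [khat]; omega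
        simp [this]
      · exact absurd h2 (by omega)
      · have : khat N k = -1 := by simp only [khat]; omega
        simp [this]
      · rfl
    simp [h0]

lemma conjTranspose_Hm_mul_S2 (N : ℕ) (α : ℝ) : (Hm N * S2 N α)ᴴ = -(Hm N * S2 N α) := by
  have h : Commute (Hm N) (S2 N α) := (commute_Hm_S1 N α).mul_right (commute_Hm_S1 N α)
  rw [h.eq, conjTranspose_mul, conjTranspose_Hm, S2, conjTranspose_mul, conjTranspose_S1,
    neg_mul_neg, ← S2, neg_mul, h.eq]

lemma conj_dotProduct_mulVec_of_skew {n : Type*} [Fintype n] {M : Matrix n n ℂ} (hM : Mᴴ = -M)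
    {u v : n → ℂ} (hu : star u = u) (hv : star v = v) :
    (starRingEnd ℂ) (v ⬝ᵥ M *ᵥ u) = -(u ⬝ᵥ M *ᵥ v) := by
  rw [starRingEnd_apply, ← star_dotProduct_star, star_mulVec, hM, hu, hv, ← dotProduct_mulVec,
    neg_mulVec, dotProduct_neg]

lemma dotProduct_weightM_mul_mulVec (N : ℕ) (α : ℝ) (x : Fin N → ℝ)
    (B : Matrix (Fin N) (Fin N) ℂ) (u v : Fin N → ℂ) :
    v ⬝ᵥ (weightM N α x * B) *ᵥ u = ∑ j, ((α ^ 2 + x j ^ 2 : ℝ) : ℂ) * (B *ᵥ u) j * v j := by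
  simp only [← mulVec_mulVec, weightM, dotProduct, mulVec_diagonal]
  exact Finset.sum_congr rfl fun j _ => mul_comm _ _

/-- For real `w`, the pairing of `f_M(w)` with `w` is purely imaginary. -/
lemma conj_sum_weight_mul_fM (N : ℕ) (hN : N ≠ 0) (α : ℝ) (hα : α ≠ 0) (x : Fin N → ℝ) (m : ℕ)
    (hm : 1 ≤ m) (w : Fin N → ℂ) (hw : star w = w) :
    (starRingEnd ℂ) (∑ j, ((α ^ 2 + x j ^ 2 : ℝ) : ℂ) * fM N α x m w j * w j)
      = -∑ j, ((α ^ 2 + x j ^ 2 : ℝ) : ℂ) * fM N α x m w j * w j := by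
  have hpw : star (pw N m w) = pw N m w := by
    funext j
    have := congrFun hw j
    simp only [Pi.star_apply] at this
    simp only [pw, Pi.star_apply, star_pow, this]
  have h1 := conjTranspose_weightM_mul N hN α hα x (S1 N α) (conjTranspose_S1 N α)
  have h2 := conjTranspose_weightM_mul N hN α hα x (Hm N * S2 N α) (conjTranspose_Hm_mul_S2 N α)
  rw [← Matrix.mul_assoc _ (Hm N)] at h2
  rw [← BS1] at h1
  rw [← BHS2] at h2
  have key : ∑ j, ((α ^ 2 + x j ^ 2 : ℝ) : ℂ) * fM N α x m w j * w j
      = w ⬝ᵥ (weightM N α x * BHS2 N α x) *ᵥ w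
        - (1 / ((m : ℂ) + 1)) * (pw N m w ⬝ᵥ (weightM N α x * BS1 N α x) *ᵥ w
          + w ⬝ᵥ (weightM N α x * BS1 N α x) *ᵥ pw N m w) := by
    simp only [dotProduct_weightM_mul_mulVec, ← Finset.sum_add_distrib, Finset.mul_sum,
      ← Finset.sum_sub_distrib]
    refine Finset.sum_congr rfl fun j _ => ?_
    have hj : pw N m w j = w j ^ (m - 1) * w j := by rw [pw, ← pow_succ, Nat.sub_add_cancel hm]
    rw [hj, fM]
    ring
  rw [key]
  simp only [map_sub, map_mul, map_add, map_div₀, map_one, map_natCast,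
    conj_dotProduct_mulVec_of_skew h2 hw hw,
    conj_dotProduct_mulVec_of_skew h1 hw hpw, conj_dotProduct_mulVec_of_skew h1 hpw hw]
  ring

/-- Theorem 3.1 (Crank–Nicholson mass conservation): if `u¹ - u⁰ = τ f_M((u⁰+u¹)/2)`,
then the discrete mass is conserved exactly: `⟨u¹, u¹⟩_h = ⟨u⁰, u⁰⟩_h`. -/
theorem crank_nicholson_mass_conservation (N : ℕ) (hN : Even N) (hN0 : 0 < N)
    (α : ℝ) (hα : 0 < α) (x : Fin N → ℝ) (m : ℕ) (hm : 1 ≤ m)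
    (τ : ℝ) (u0 u1 : Fin N → ℝ)
    (hscheme : cv N u1 - cv N u0
      = (τ : ℂ) • fM N α x m ((cv N u0 + cv N u1) / 2)) :
    iph N α x (cv N u1) (cv N u1) = iph N α x (cv N u0) (cv N u0) := by
  have hw : star ((cv N u0 + cv N u1) / 2) = (cv N u0 + cv N u1) / 2 := by
    funext j
    simp [cv]
  have hT := conj_sum_weight_mul_fM N hN0.ne' α hα.ne' x m hm _ hw
  set w := (cv N u0 + cv N u1) / 2 with hw_def
  set T := ∑ j, ((α ^ 2 + x j ^ 2 : ℝ) : ℂ) * fM N α x m w j * w j with hT_def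
  have hD : ((∑ j, (α ^ 2 + x j ^ 2) * (u1 j ^ 2 - u0 j ^ 2) : ℝ) : ℂ) = 2 * (τ : ℂ) * T := by
    rw [hT_def, Finset.mul_sum, ofReal_sum]
    refine Finset.sum_congr rfl fun j _ => ?_
    have hj : (u1 j : ℂ) - u0 j = τ * fM N α x m w j := congrFun hscheme j
    have hwj : w j = ((u0 j : ℂ) + u1 j) / 2 := rfl
    rw [hwj]
    push_cast
    linear_combination ((α : ℂ) ^ 2 + (x j : ℂ) ^ 2) * ((u0 j : ℂ) + u1 j) * hj
  have hD' := congrArg (starRingEnd ℂ) hD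
  rw [conj_ofReal, map_mul, map_mul, conj_ofReal, hT, map_ofNat] at hD'
  have hsum : ∑ j, ((α ^ 2 + x j ^ 2 : ℝ) : ℂ) * cv N u1 j * (starRingEnd ℂ) (cv N u1 j)
      - ∑ j, ((α ^ 2 + x j ^ 2 : ℝ) : ℂ) * cv N u0 j * (starRingEnd ℂ) (cv N u0 j)
      = ((∑ j, (α ^ 2 + x j ^ 2) * (u1 j ^ 2 - u0 j ^ 2) : ℝ) : ℂ) := by
    rw [← Finset.sum_sub_distrib, ofReal_sum]
    refine Finset.sum_congr rfl fun j _ => ?_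
    simp only [cv, conj_ofReal]
    push_cast
    ring
  rw [iph, iph]
  congr 1
  linear_combination hsum + (hD + hD') / 2
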